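/- arXiv:1810.05256 — 3 statements merged into one kernel-verified Lean document; each statement's English description precedes it below -/
import Mathlib

section
/- (Single supermajority.) In the Aleph poset model with a level function L, candidate prime unit U_c, coin function, and functions Π, Δ satisfying the Aleph recurrences: if U is a prime unit with R(U) = 1 and Π(U) ≠ none, then every prime unit V with L(V) = L(U) satisfies Π(V) = Π(U) or Π(V) = none. -/
open scoped Classical

/-- The number of distinct creators of units in `S` (the support count `#ₛS`). -/
noncomputable def suppCount {N : ℕ} {P : Type*} (c : P → Fin N) (S : Set P) : ℕ :=
  (c '' S).ncard

/-- `HighAbove c V U` means `V ≫ U`: `U ≤ V` and the units between `U` and `V`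
have at least `2N/3` distinct creators. -/
def HighAbove {N : ℕ} {P : Type*} [PartialOrder P] (c : P → Fin N) (V U : P) : Prop :=
  U ≤ V ∧ 2 * N ≤ 3 * suppCount c {W | U ≤ W ∧ W ≤ V}

/-- A unit `U` is prime if no unit `V < U` with the same creator has the same level. -/
def IsPrime {N : ℕ} {P : Type*} [PartialOrder P] (c : P → Fin N) (L : P → ℕ) (U : P) : Prop :=
  ¬ ∃ V, V < U ∧ c V = c U ∧ L V = L U

/-- `L` is a level function: it is monotone and every unit `W` of level `≥ 1` is high above
prime units of level `L W - 1` created by at least `2N/3` distinct processes. -/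
def IsLevelFn {N : ℕ} {P : Type*} [PartialOrder P] (c : P → Fin N) (L : P → ℕ) : Prop :=
  Monotone L ∧ ∀ W : P, 1 ≤ L W →
    2 * N ≤ 3 * suppCount c {X | HighAbove c W X ∧ L X = L W - 1 ∧ IsPrime c L X}

/-- The set `⇓U` of prime ancestors of `U`: prime units of level `L U - 1` high below `U`. -/
def primeAnc {N : ℕ} {P : Type*} [PartialOrder P] (c : P → Fin N) (L : P → ℕ) (U : P) :
    Set P :=
  {W | IsPrime c L W ∧ HighAbove c U W ∧ L W = L U - 1}

/-- The supermajority operator. -/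
noncomputable def SupMaj {N : ℕ} {P : Type*} (c : P → Fin N) (S : Set P)
    (f : P → Option Bool) : Option Bool :=
  if 2 * N ≤ 3 * suppCount c {U ∈ S | f U = some true} then some true
  else if 2 * N ≤ 3 * suppCount c {U ∈ S | f U = some false} then some false
  else none

/-- The existence operator (with preference for `true`). -/
noncomputable def ExistOp {P : Type*} (S : Set P) (f : P → Option Bool) : Option Bool :=
  if ∃ U ∈ S, f U = some true then some true
  else if ∃ U ∈ S, f U = some false then some false
  else none

/-- The randomized existence operator: as `ExistOp`, but falling back to the threshold coin.
Here `ℓ` is the level of the unit whose prime ancestors form `S` (so units of `S` have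
level `ℓ - 1`, and the coin with nonce `ℓ - 1` is used). -/
noncomputable def ExistTC {P : Type*} (coin : ℕ → Bool) (S : Set P)
    (f : P → Option Bool) (ℓ : ℕ) : Option Bool :=
  match ExistOp S f with
  | none => some (coin (ℓ - 1))
  | some b => some b

/-- The round type of a prime unit `U` relative to the candidate `Uc`:
`none` (⊥) for preliminary rounds, `some 0` for even and `some 1` for odd rounds. -/
def roundType {P : Type*} [PartialOrder P] (L : P → ℕ) (Uc U : P) : Option ℕ :=
  if L U ≤ L Uc + 1 then none else some ((L U - L Uc) % 2)

/-- The Aleph recurrences for the proposal function `Pi` and the decision function `Delta`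
with respect to the candidate prime unit `Uc` and the threshold coin `coin`. -/
def AlephRec {N : ℕ} {P : Type*} [PartialOrder P] (c : P → Fin N) (L : P → ℕ)
    (Uc : P) (coin : ℕ → Bool) (Pi Delta : P → Option Bool) : Prop :=
  ∀ U : P, IsPrime c L U →
    (roundType L Uc U = none →
      Pi U = some (decide (Uc ≤ U)) ∧ Delta U = none) ∧
    (roundType L Uc U = some 1 →
      Pi U = SupMaj c (primeAnc c L U) Pi ∧ Delta U = ExistOp (primeAnc c L U) Delta) ∧
    (roundType L Uc U = some 0 →
      Pi U = ExistTC coin (primeAnc c L U) Pi (L U) ∧ Delta U = SupMaj c (primeAnc c L U) Pi)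

/-- Two sets of creators with at least `2N/3` elements each share a correct process. -/
theorem exists_mem_correct_of_two_thirds {N : ℕ} {Correct : Finset (Fin N)}
    (hfaulty : 3 * ((Finset.univ : Finset (Fin N)) \ Correct).card < N) {A B : Set (Fin N)}
    (hA : 2 * N ≤ 3 * A.ncard) (hB : 2 * N ≤ 3 * B.ncard) :
    ∃ i ∈ Correct, i ∈ A ∧ i ∈ B := by
  by_contra! h
  have hsub : A ∩ B ⊆ ((Finset.univ \ Correct : Finset (Fin N)) : Set (Fin N)) := by
    rintro i ⟨hiA, hiB⟩
    simpa using fun hi => h i hi hiA hiB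
  have hinter := Set.ncard_le_ncard hsub (Set.toFinite _)
  rw [Set.ncard_coe_finset] at hinter
  have hadd := Set.ncard_union_add_ncard_inter A B
  have hunion : (A ∪ B).ncard ≤ N := by
    simpa using Set.ncard_le_card (A ∪ B)
  omega

/-- Comparable prime units with the same creator and the same level are equal. -/
theorem IsPrime.eq_of_comparable {N : ℕ} {P : Type*} [PartialOrder P] {c : P → Fin N}
    {L : P → ℕ} {X Y : P} (hX : IsPrime c L X) (hY : IsPrime c L Y) (hc : c X = c Y)
    (hL : L X = L Y) (h : X ≤ Y ∨ Y ≤ X) : X = Y := by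
  rcases h with h | h
  · by_contra hne
    exact hY ⟨X, lt_of_le_of_ne h hne, hc, hL⟩
  · by_contra hne
    exact hX ⟨Y, lt_of_le_of_ne h (Ne.symm hne), hc.symm, hL.symm⟩

/-- A value returned by `SupMaj` is supported by at least `2N/3` creators. -/
theorem two_thirds_le_of_supMaj_eq_some {N : ℕ} {P : Type*} {c : P → Fin N} {S : Set P}
    {f : P → Option Bool} {b : Bool} (h : SupMaj c S f = some b) :
    2 * N ≤ 3 * suppCount c {U ∈ S | f U = some b} := by
  unfold SupMaj at h
  split_ifs at h <;> cases h <;> assumption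

/-- **Single supermajority.** If `U` is a prime unit in an odd round with `Π U ≠ none`,
then every prime unit `V` of the same level has `Π V = Π U` or `Π V = none`. -/
theorem aleph_single_supermajority {P : Type*} [PartialOrder P] [Fintype P] {N : ℕ} (hN : 0 < N)
    (c : P → Fin N) (Correct : Finset (Fin N))
    (hfaulty : 3 * ((Finset.univ : Finset (Fin N)) \ Correct).card < N)
    (hchain : ∀ U V : P, c U = c V → c U ∈ Correct → U ≤ V ∨ V ≤ U)
    (L : P → ℕ) (hL : IsLevelFn c L)
    (Uc : P) (hUc : IsPrime c L Uc) (coin : ℕ → Bool)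
    (Pi Delta : P → Option Bool) (hrec : AlephRec c L Uc coin Pi Delta)
    (U : P) (hU : IsPrime c L U) (hR : roundType L Uc U = some 1) (hPi : Pi U ≠ none)
    (V : P) (hV : IsPrime c L V) (hlev : L V = L U) :
    Pi V = Pi U ∨ Pi V = none := by
  have hRV : roundType L Uc V = some 1 := by
    simpa only [roundType, hlev] using hR
  have hPU := ((hrec U hU).2.1 hR).1
  have hPV := ((hrec V hV).2.1 hRV).1
  cases hu : Pi U with
  | none => exact absurd hu hPi
  | some a =>
    cases hv : Pi V with
    | none => exact Or.inr rfl
    | some b =>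
      left
      obtain ⟨i, hi, ⟨X, ⟨⟨hXp, -, hXL⟩, hXa⟩, hXi⟩, ⟨Y, ⟨⟨hYp, -, hYL⟩, hYb⟩, hYi⟩⟩ :=
        exists_mem_correct_of_two_thirds hfaulty
          (two_thirds_le_of_supMaj_eq_some (hPU.symm.trans hu))
          (two_thirds_le_of_supMaj_eq_some (hPV.symm.trans hv))
      have hc : c X = c Y := hXi.trans hYi.symm
      have hXY : X = Y := hXp.eq_of_comparable hYp hc (by rw [hXL, hYL, hlev])
        (hchain X Y hc (hXi ▸ hi))
      rw [← hYb, ← hXa, hXY]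
end

section
/- (Necessity of positive decisions.) In the Aleph poset model with a level function L: let U₁ be a prime unit with L(U₁) = l + 1 (l ≥ 0) such that there is no other prime unit V < U₁ with L(V) = l + 1. Then for every U_c ∈ ⇓U₁, taking U_c as the candidate in the Aleph recurrences (with any coin function and any Π, Δ satisfying the recurrences for this U_c), every prime unit U₄ with L(U₄) = l + 4 satisfies Δ(U₄) = some true. -/
open scoped Classical

/-- Two sets of units, each with at least `2N/3` distinct creators, share a correct creator. -/
theorem exists_correct_common_creator {P : Type*} {N : ℕ} (c : P → Fin N)
    (Correct : Finset (Fin N))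
    (hfaulty : 3 * ((Finset.univ : Finset (Fin N)) \ Correct).card < N)
    {S T : Set P} (hS : 2 * N ≤ 3 * suppCount c S) (hT : 2 * N ≤ 3 * suppCount c T) :
    ∃ U ∈ S, ∃ V ∈ T, c U = c V ∧ c U ∈ Correct := by
  by_contra! h
  have hsub : c '' S ∩ c '' T ⊆ ((Finset.univ \ Correct : Finset (Fin N)) : Set (Fin N)) := by
    rintro _ ⟨⟨U, hU, rfl⟩, V, hV, hVU⟩
    simpa using h U hU V hV hVU.symm
  have hinter := Set.ncard_le_ncard hsub
  rw [Set.ncard_coe_finset] at hinter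
  have hunion := Set.ncard_le_card (c '' S ∪ c '' T)
  rw [Nat.card_eq_fintype_card, Fintype.card_fin] at hunion
  have hsum := Set.ncard_union_add_ncard_inter (c '' S) (c '' T)
  unfold suppCount at hS hT
  omega

/-- The prime ancestors of a unit of positive level have at least `2N/3` distinct creators. -/
theorem IsLevelFn.two_mul_le_suppCount_primeAnc {P : Type*} [PartialOrder P] {N : ℕ}
    {c : P → Fin N} {L : P → ℕ} (hL : IsLevelFn c L) {U : P} (hU : 1 ≤ L U) :
    2 * N ≤ 3 * suppCount c (primeAnc c L U) := by
  convert hL.2 U hU using 4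
  ext X
  exact ⟨fun h => ⟨h.2.1, h.2.2, h.1⟩, fun h => ⟨h.2.2, h.1, h.2.1⟩⟩

theorem supMaj_eq_true {P : Type*} {N : ℕ} {c : P → Fin N} {S : Set P} {f : P → Option Bool}
    (hS : 2 * N ≤ 3 * suppCount c S) (hf : ∀ U ∈ S, f U = some true) :
    SupMaj c S f = some true := by
  have hset : {U ∈ S | f U = some true} = S := Set.sep_eq_self_iff_mem_true.2 hf
  rw [SupMaj, hset, if_pos hS]

theorem existTC_eq_true {P : Type*} {coin : ℕ → Bool} {S : Set P} {f : P → Option Bool} {ℓ : ℕ}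
    (h : ∃ U ∈ S, f U = some true) : ExistTC coin S f ℓ = some true := by
  simp only [ExistTC, ExistOp, if_pos h]

/-- If `U₁` is a minimal prime unit of its level and high above `Uc`, then every unit of the
next level has a prime ancestor above `Uc`. -/
theorem exists_mem_primeAnc_ge {P : Type*} [PartialOrder P] {N : ℕ}
    {c : P → Fin N} {Correct : Finset (Fin N)}
    (hfaulty : 3 * ((Finset.univ : Finset (Fin N)) \ Correct).card < N)
    (hchain : ∀ U V : P, c U = c V → c U ∈ Correct → U ≤ V ∨ V ≤ U)
    {L : P → ℕ} (hL : IsLevelFn c L) {m : ℕ} {U₁ Uc U₂ : P}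
    (honly : ∀ V : P, IsPrime c L V → V < U₁ → L V ≠ m)
    (hUc : HighAbove c U₁ Uc) (hU₂lev : L U₂ = m + 1) :
    ∃ V ∈ primeAnc c L U₂, Uc ≤ V := by
  obtain ⟨V, hV, W, ⟨hUcW, hWU₁⟩, hVW, hVc⟩ := exists_correct_common_creator c Correct hfaulty
    (hL.two_mul_le_suppCount_primeAnc (U := U₂) (by omega)) hUc.2
  refine ⟨V, hV, ?_⟩
  rcases hchain V W hVW hVc with hle | hle
  · rcases (hle.trans hWU₁).eq_or_lt with rfl | hlt
    · exact hUc.1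
    · have hVlev := hV.2.2
      exact absurd (by omega) (honly V hV.1 hlt)
  · exact hUcW.trans hle

/-- **Necessity of positive decisions.** If `U₁` is a prime unit of level `l + 1` with no
other prime unit of that level below it, then every candidate `Uc ∈ ⇓U₁` is decided `true`
by every prime unit of level `l + 4`. -/
theorem aleph_necessity_of_positive_decisions {P : Type*} [PartialOrder P] [Fintype P] {N : ℕ} (hN : 0 < N)
    (c : P → Fin N) (Correct : Finset (Fin N))
    (hfaulty : 3 * ((Finset.univ : Finset (Fin N)) \ Correct).card < N)
    (hchain : ∀ U V : P, c U = c V → c U ∈ Correct → U ≤ V ∨ V ≤ U)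
    (L : P → ℕ) (hL : IsLevelFn c L)
    (l : ℕ) (U₁ : P) (hU₁ : IsPrime c L U₁) (hU₁lev : L U₁ = l + 1)
    (honly : ∀ V : P, IsPrime c L V → V < U₁ → L V ≠ l + 1)
    (Uc : P) (hUc : Uc ∈ primeAnc c L U₁)
    (coin : ℕ → Bool) (Pi Delta : P → Option Bool)
    (hrec : AlephRec c L Uc coin Pi Delta)
    (U₄ : P) (hU₄ : IsPrime c L U₄) (hU₄lev : L U₄ = l + 4) :
    Delta U₄ = some true := by
  have hUclev : L Uc = l := by
    have := hUc.2.2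
    omega
  have pi_one : ∀ V, IsPrime c L V → L V = l + 1 → Uc ≤ V → Pi V = some true := by
    intro V hV hVlev hle
    rw [((hrec V hV).1 (by simp [roundType, hUclev, hVlev])).1, decide_eq_true hle]
  have pi_two : ∀ V, IsPrime c L V → L V = l + 2 → Pi V = some true := by
    intro V hV hVlev
    rw [((hrec V hV).2.2 (by simp [roundType, hUclev, hVlev])).1]
    obtain ⟨W, hW, hle⟩ := exists_mem_primeAnc_ge hfaulty hchain hL honly hUc.2.1 hVlev
    exact existTC_eq_true ⟨W, hW, pi_one W hW.1 (by have := hW.2.2; omega) hle⟩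
  have pi_three : ∀ V, IsPrime c L V → L V = l + 3 → Pi V = some true := by
    intro V hV hVlev
    rw [((hrec V hV).2.1 (by simp [roundType, hUclev, hVlev])).1]
    exact supMaj_eq_true (hL.two_mul_le_suppCount_primeAnc (by omega))
      fun W hW => pi_two W hW.1 (by have := hW.2.2; omega)
  rw [((hrec U₄ hU₄).2.2 (by simp [roundType, hUclev, hU₄lev])).2]
  exact supMaj_eq_true (hL.two_mul_le_suppCount_primeAnc (by omega))
    fun W hW => pi_three W hW.1 (by have := hW.2.2; omega)
end

section
/- (Negative decisions for hidden units.) In the Aleph poset model with a level function L, candidate prime unit U_c, coin function, and functions Π, Δ satisfying the Aleph recurrences: if there exists a prime unit V with L(V) = L(U_c) + 4 and ¬(U_c ≤ V), then every prime unit W with L(W) ≥ L(U_c) + 4 satisfies Δ(W) = none or Δ(W) = some false. -/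
open scoped Classical

theorem suppCount_mono {N : ℕ} {P : Type*} (c : P → Fin N) {S T : Set P} (h : S ⊆ T) :
    suppCount c S ≤ suppCount c T :=
  Set.ncard_le_ncard (Set.image_mono h) (Set.toFinite _)

theorem nonempty_of_quorum {N : ℕ} {P : Type*} (hN : 0 < N) {c : P → Fin N} {S : Set P}
    (h : 2 * N ≤ 3 * suppCount c S) : S.Nonempty := by
  rw [Set.nonempty_iff_ne_empty]
  rintro rfl
  simp only [suppCount, Set.image_empty, Set.ncard_empty] at h
  omega

/-- Two quorums of units have members with a common correct creator. -/
theorem exists_correct_of_quorums {N : ℕ} {P : Type*} {c : P → Fin N} {Correct : Finset (Fin N)}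
    (hfaulty : 3 * ((Finset.univ : Finset (Fin N)) \ Correct).card < N) {S T : Set P}
    (hS : 2 * N ≤ 3 * suppCount c S) (hT : 2 * N ≤ 3 * suppCount c T) :
    ∃ X ∈ S, ∃ Y ∈ T, c X = c Y ∧ c X ∈ Correct := by
  by_contra! h
  have hsub : c '' S ∩ c '' T ⊆ ((Finset.univ \ Correct : Finset (Fin N)) : Set (Fin N)) := by
    rintro _ ⟨⟨X, hX, rfl⟩, Y, hY, hYX⟩
    simpa using h X hX Y hY hYX.symm
  have hinter := Set.ncard_le_ncard hsub (Set.toFinite _)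
  rw [Set.ncard_coe_finset] at hinter
  have hunion : (c '' S ∪ c '' T).ncard ≤ N := by
    simpa using Set.ncard_le_card (c '' S ∪ c '' T)
  have := Set.ncard_union_add_ncard_inter (c '' S) (c '' T)
  unfold suppCount at hS hT
  omega

/-- A correct process creates at most one prime unit per level. -/
theorem eq_of_isPrime {N : ℕ} {P : Type*} [PartialOrder P] {c : P → Fin N} {L : P → ℕ}
    {U V : P} (hU : IsPrime c L U) (hV : IsPrime c L V) (hc : c U = c V) (hLev : L U = L V)
    (hcomp : U ≤ V ∨ V ≤ U) : U = V := by
  by_contra hne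
  rcases hcomp with h | h
  · exact hV ⟨U, lt_of_le_of_ne h hne, hc, hLev⟩
  · exact hU ⟨V, lt_of_le_of_ne h (Ne.symm hne), hc.symm, hLev.symm⟩

/-- Two quorums of prime units of the same level intersect. -/
theorem inter_nonempty_of_quorums {N : ℕ} {P : Type*} [PartialOrder P] {c : P → Fin N}
    {Correct : Finset (Fin N)}
    (hfaulty : 3 * ((Finset.univ : Finset (Fin N)) \ Correct).card < N)
    (hchain : ∀ U V : P, c U = c V → c U ∈ Correct → U ≤ V ∨ V ≤ U) {L : P → ℕ} {S T : Set P}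
    (hS : 2 * N ≤ 3 * suppCount c S) (hT : 2 * N ≤ 3 * suppCount c T) {n : ℕ}
    (hSn : ∀ X ∈ S, IsPrime c L X ∧ L X = n) (hTn : ∀ X ∈ T, IsPrime c L X ∧ L X = n) :
    (S ∩ T).Nonempty := by
  obtain ⟨X, hX, Y, hY, hXY, hc⟩ := exists_correct_of_quorums hfaulty hS hT
  have := eq_of_isPrime (hSn X hX).1 (hTn Y hY).1 hXY ((hSn X hX).2.trans (hTn Y hY).2.symm)
    (hchain X Y hXY hc)
  exact ⟨X, hX, this ▸ hY⟩

theorem quorum_primeAnc {N : ℕ} {P : Type*} [PartialOrder P] {c : P → Fin N} {L : P → ℕ}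
    (hL : IsLevelFn c L) {U : P} (hU : 1 ≤ L U) : 2 * N ≤ 3 * suppCount c (primeAnc c L U) := by
  have := suppCount_mono c (show {X | HighAbove c U X ∧ L X = L U - 1 ∧ IsPrime c L X} ⊆
    primeAnc c L U from fun X hX => ⟨hX.2.2, hX.1, hX.2.1⟩)
  have := hL.2 U hU
  omega

theorem quorum_of_SupMaj_eq_true {N : ℕ} {P : Type*} {c : P → Fin N} {S : Set P}
    {f : P → Option Bool} (h : SupMaj c S f = some true) :
    2 * N ≤ 3 * suppCount c {U ∈ S | f U = some true} := by
  by_contra hlt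
  rw [SupMaj, if_neg hlt] at h
  split_ifs at h
  simp at h

theorem SupMaj_eq_false {N : ℕ} {P : Type*} (hN : 0 < N) {c : P → Fin N} {S : Set P}
    {f : P → Option Bool} (hS : 2 * N ≤ 3 * suppCount c S) (hf : ∀ U ∈ S, f U = some false) :
    SupMaj c S f = some false := by
  have hfalse : {U ∈ S | f U = some false} = S := Set.sep_eq_self_iff_mem_true.2 hf
  unfold SupMaj
  rw [if_neg, if_pos (by rwa [hfalse])]
  intro h
  obtain ⟨X, hX, hXt⟩ := nonempty_of_quorum hN h
  simp [hf X hX] at hXt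

theorem ExistTC_eq_false {P : Type*} {coin : ℕ → Bool} {S : Set P} {f : P → Option Bool}
    {ℓ : ℕ} (ht : ∀ U ∈ S, f U ≠ some true) (hf : ∃ U ∈ S, f U = some false) :
    ExistTC coin S f ℓ = some false := by
  have : ExistOp S f = some false := by
    unfold ExistOp
    rw [if_neg (by simpa using ht), if_pos hf]
  simp [ExistTC, this]

theorem ExistOp_ne_true {P : Type*} {S : Set P} {f : P → Option Bool}
    (ht : ∀ U ∈ S, f U ≠ some true) : ExistOp S f ≠ some true := by
  unfold ExistOp
  rw [if_neg (by simpa using ht)]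
  split_ifs <;> simp

theorem roundType_add {P : Type*} [PartialOrder P] {L : P → ℕ} {Uc U : P} {k : ℕ}
    (hk : 2 ≤ k) (hU : L U = L Uc + k) : roundType L Uc U = some (k % 2) := by
  unfold roundType
  rw [if_neg (by omega), hU, Nat.add_sub_cancel_left]

/-- **Negative decisions for hidden units.** If some prime unit `V` of level `L Uc + 4` is
not above `Uc`, then every prime unit `W` of level at least `L Uc + 4` has
`Δ W = none` or `Δ W = some false`. -/
theorem aleph_negative_decisions_for_hidden_units {P : Type*} [PartialOrder P] [Fintype P] {N : ℕ} (hN : 0 < N)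
    (c : P → Fin N) (Correct : Finset (Fin N))
    (hfaulty : 3 * ((Finset.univ : Finset (Fin N)) \ Correct).card < N)
    (hchain : ∀ U V : P, c U = c V → c U ∈ Correct → U ≤ V ∨ V ≤ U)
    (L : P → ℕ) (hL : IsLevelFn c L)
    (Uc : P) (hUc : IsPrime c L Uc) (coin : ℕ → Bool)
    (Pi Delta : P → Option Bool) (hrec : AlephRec c L Uc coin Pi Delta)
    (V : P) (hV : IsPrime c L V) (hVlev : L V = L Uc + 4) (hVnot : ¬ Uc ≤ V)
    (W : P) (hW : IsPrime c L W) (hWlev : L Uc + 4 ≤ L W) :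
    Delta W = none ∨ Delta W = some false := by
  have hlev : ∀ {k U X}, L U = L Uc + (k + 1) → X ∈ primeAnc c L U → L X = L Uc + k := by
    intro k U X hU hX
    have := hX.2.2
    omega
  have hquorum : ∀ {k U}, L U = L Uc + (k + 1) →
      2 * N ≤ 3 * suppCount c (primeAnc c L U) :=
    fun hU => quorum_primeAnc hL (by omega)
  have hbelow_two : ∀ U, IsPrime c L U → L U = L Uc + 2 → U ≤ V → Pi U = some false := by
    intro U hU hUl hUV
    rw [((hrec U hU).2.2 (roundType_add le_rfl hUl)).1]
    have hPi : ∀ X ∈ primeAnc c L U, Pi X = some false := by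
      intro X hX
      have hXl := hlev hUl hX
      rw [((hrec X hX.1).1 (if_pos hXl.le)).1,
        decide_eq_false fun h => hVnot (h.trans (hX.2.1.1.trans hUV))]
    obtain ⟨X, hX⟩ := nonempty_of_quorum hN (hquorum hUl)
    exact ExistTC_eq_false (fun Y hY => by simp [hPi Y hY]) ⟨X, hX, hPi X hX⟩
  have hanc_two : ∀ U ∈ primeAnc c L V, ∀ X ∈ primeAnc c L U, Pi X = some false :=
    fun U hU X hX => hbelow_two X hX.1 (hlev (hlev hVlev hU) hX)
      (hX.2.1.1.trans hU.2.1.1)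
  have hanc_three : ∀ U ∈ primeAnc c L V, Pi U = some false := by
    intro U hU
    have hUl := hlev hVlev hU
    rw [((hrec U hU.1).2.1 (roundType_add (by omega) hUl)).1]
    exact SupMaj_eq_false hN (hquorum hUl) (hanc_two U hU)
  have hthree : ∀ U, IsPrime c L U → L U = L Uc + 3 → Pi U ≠ some true := by
    intro U hU hUl ht
    rw [((hrec U hU).2.1 (roundType_add (by omega) hUl)).1] at ht
    obtain ⟨A, hA⟩ := nonempty_of_quorum hN (hquorum hVlev)
    have hAl := hlev hVlev hA
    obtain ⟨X, hX, hXA⟩ := inter_nonempty_of_quorums hfaulty hchain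
      (quorum_of_SupMaj_eq_true ht) (hquorum hAl)
      (fun X hX => ⟨hX.1.1, hlev hUl hX.1⟩) (fun X hX => ⟨hX.1, hlev hAl hX⟩)
    simpa [hanc_two A hA X hXA] using hX.2
  have hall : ∀ k, 4 ≤ k → ∀ U, IsPrime c L U → L U = L Uc + k →
      Pi U = some false ∧ Delta U ≠ some true := by
    intro k hk
    induction k, hk using Nat.le_induction with
    | base =>
      intro U hU hUl
      obtain ⟨hPi, hDelta⟩ := (hrec U hU).2.2 (roundType_add (by omega) hUl)
      have hnt : ∀ X ∈ primeAnc c L U, Pi X ≠ some true :=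
        fun X hX => hthree X hX.1 (hlev hUl hX)
      constructor
      · obtain ⟨X, hX, hXV⟩ := inter_nonempty_of_quorums hfaulty hchain
          (hquorum hUl) (hquorum hVlev)
          (fun X hX => ⟨hX.1, hlev hUl hX⟩) (fun X hX => ⟨hX.1, hlev hVlev hX⟩)
        rw [hPi]
        exact ExistTC_eq_false hnt ⟨X, hX, hanc_three X hXV⟩
      · rw [hDelta]
        intro ht
        obtain ⟨X, hX, hXt⟩ := nonempty_of_quorum hN (quorum_of_SupMaj_eq_true ht)
        exact hnt X hX hXt
    | succ k hk ih =>
      intro U hU hUl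
      have hPi : ∀ X ∈ primeAnc c L U, Pi X = some false :=
        fun X hX => (ih X hX.1 (hlev hUl hX)).1
      have hSup := SupMaj_eq_false hN (hquorum hUl) hPi
      have hround := roundType_add (by omega) hUl
      rcases Nat.mod_two_eq_zero_or_one (k + 1) with hpar | hpar <;> rw [hpar] at hround
      · obtain ⟨hP, hD⟩ := (hrec U hU).2.2 hround
        obtain ⟨X, hX⟩ := nonempty_of_quorum hN (hquorum hUl)
        rw [hP, hD, hSup]
        exact ⟨ExistTC_eq_false (fun Y hY => by simp [hPi Y hY]) ⟨X, hX, hPi X hX⟩, by simp⟩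
      · obtain ⟨hP, hD⟩ := (hrec U hU).2.1 hround
        rw [hP, hD]
        exact ⟨hSup, ExistOp_ne_true fun X hX => (ih X hX.1 (hlev hUl hX)).2⟩
  have hWne := (hall (L W - L Uc) (by omega) W hW (by omega)).2
  rcases hD : Delta W with _ | _ | _
  · exact Or.inl rfl
  · exact Or.inr rfl
  · exact absurd hD hWne
end
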